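/- For every real α ≥ 0 and every complex z with Re z > 0: L(χ_α ∗ ν)(z) = exp(−α·√z) · Ψ(−√z)/z, where the convolution χ_α ∗ ν is taken on (0,∞). -/

import Mathlib

open MeasureTheory Set
open scoped Real

/-- The function `Ψ(w) = ∫₀^∞ x·exp(−x²/2 + w·x) dx`. -/
noncomputable def Psi (w : ℂ) : ℂ :=
  ∫ x in Ioi (0:ℝ), (x:ℂ) * Complex.exp (-(x:ℂ)^2/2 + w * x)

/-- The principal branch of the complex square root. -/
noncomputable def csqrt (z : ℂ) : ℂ := z ^ (1/2 : ℂ)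

/-- The Laplace transform `L(f)(z) = ∫₀^∞ exp(−z·u)·f(u) du`. -/
noncomputable def laplace (f : ℝ → ℝ) (z : ℂ) : ℂ :=
  ∫ u in Ioi (0:ℝ), Complex.exp (-z * u) * (f u : ℂ)

/-- The function `ν(u) = (2/√π)·√u/(2u+1)`. -/
noncomputable def nu (u : ℝ) : ℝ := (2 / Real.sqrt π) * Real.sqrt u / (2*u + 1)

/-- Convolution on `(0,∞)`: `(f ∗ g)(u) = ∫₀ᵘ f(s)·g(u−s) ds`. -/
noncomputable def pconv (f g : ℝ → ℝ) (u : ℝ) : ℝ := ∫ s in (0:ℝ)..u, f s * g (u - s)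

/-- The function `χ_α(u) = (1/√(πu))·exp(−α²/(4u))`. -/
noncomputable def chi (α : ℝ) (u : ℝ) : ℝ := (1 / Real.sqrt (π * u)) * Real.exp (-α^2/(4*u))

open Filter Topology

/-- The unnormalised error function `x ↦ ∫₀ˣ exp(−s²) ds`. -/
noncomputable def gaussPrim (x : ℝ) : ℝ := ∫ s in (0:ℝ)..x, Real.exp (-1 * s ^ 2)

lemma hasDerivAt_gaussPrim (x : ℝ) : HasDerivAt gaussPrim (Real.exp (-1 * x ^ 2)) x := by
  have hc : Continuous fun s : ℝ => Real.exp (-1 * s ^ 2) := by fun_prop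
  exact intervalIntegral.integral_hasDerivAt_right (hc.intervalIntegrable _ _)
    (hc.stronglyMeasurableAtFilter _ _) hc.continuousAt

lemma tendsto_gaussPrim_atTop : Tendsto gaussPrim atTop (𝓝 (√π / 2)) := by
  have h := intervalIntegral_tendsto_integral_Ioi (μ := volume) (0:ℝ)
    ((integrable_exp_neg_mul_sq (b := 1) one_pos).integrableOn) tendsto_id
  rw [integral_gaussian_Ioi, div_one] at h
  exact h

lemma gaussPrim_neg (x : ℝ) : gaussPrim (-x) = -gaussPrim x := by
  have h := intervalIntegral.integral_comp_neg (a := 0) (b := x)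
    (fun s : ℝ => Real.exp (-1 * s ^ 2))
  simp only [neg_sq, neg_zero] at h
  rw [gaussPrim, gaussPrim, h, intervalIntegral.integral_symm]

lemma tendsto_gaussPrim_atBot : Tendsto gaussPrim atBot (𝓝 (-(√π / 2))) := by
  have h := (tendsto_gaussPrim_atTop.comp tendsto_neg_atBot_atTop).neg
  refine h.congr fun x => ?_
  simp [gaussPrim_neg]

/-- A primitive of `u ↦ w√π·exp(−w²u)·χ_α(u)` on `(0,∞)`. -/
noncomputable def chiPrim (α w u : ℝ) : ℝ :=
  Real.exp (w * α) * gaussPrim (w * √u + α / 2 * (√u)⁻¹) +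
    Real.exp (-(w * α)) * gaussPrim (w * √u - α / 2 * (√u)⁻¹)

lemma hasDerivAt_chiPrim (α w : ℝ) {u : ℝ} (hu : 0 < u) :
    HasDerivAt (chiPrim α w) (w * √π * (Real.exp (-w ^ 2 * u) * chi α u)) u := by
  have hs : 0 < √u := Real.sqrt_pos.2 hu
  have h0 := Real.hasDerivAt_sqrt hu.ne'
  have h1 := h0.inv hs.ne'
  have hp := (h0.const_mul w).add (h1.const_mul (α / 2))
  have hm := (h0.const_mul w).sub (h1.const_mul (α / 2))
  have hP := ((hasDerivAt_gaussPrim _).comp u hp).const_mul (Real.exp (w * α))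
  have hM := ((hasDerivAt_gaussPrim _).comp u hm).const_mul (Real.exp (-(w * α)))
  refine (hP.add hM).congr_deriv ?_
  simp only [Pi.add_apply, Pi.sub_apply, Pi.inv_apply]
  rw [← mul_assoc, ← mul_assoc, ← Real.exp_add, ← Real.exp_add]
  have hsq : √u ^ 2 = u := Real.sq_sqrt hu.le
  have e1 : w * α + -1 * (w * √u + α / 2 * (√u)⁻¹) ^ 2 = -w ^ 2 * u + -α ^ 2 / (4 * u) := by
    rw [← hsq, Real.sqrt_sq hs.le]; field_simp; ring
  have e2 : -(w * α) + -1 * (w * √u - α / 2 * (√u)⁻¹) ^ 2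
      = -w ^ 2 * u + -α ^ 2 / (4 * u) := by
    rw [← hsq, Real.sqrt_sq hs.le]; field_simp; ring
  rw [e1, e2, Real.exp_add, chi, Real.sqrt_mul Real.pi_pos.le]
  have hpi : 0 < √π := Real.sqrt_pos.2 Real.pi_pos
  field_simp
  ring

lemma tendsto_chiPrim_atTop (α : ℝ) {w : ℝ} (hw : 0 < w) :
    Tendsto (chiPrim α w) atTop
      (𝓝 (Real.exp (w * α) * (√π / 2) + Real.exp (-(w * α)) * (√π / 2))) := by
  have h1 : Tendsto (fun u : ℝ => w * √u) atTop atTop :=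
    Real.tendsto_sqrt_atTop.const_mul_atTop hw
  have h2 : Tendsto (fun u : ℝ => α / 2 * (√u)⁻¹) atTop (𝓝 (α / 2 * 0)) :=
    (tendsto_inv_atTop_zero.comp Real.tendsto_sqrt_atTop).const_mul _
  have h3 := h1.atTop_add h2
  have h4 : Tendsto (fun u : ℝ => w * √u - α / 2 * (√u)⁻¹) atTop atTop := by
    simpa [sub_eq_add_neg] using h1.atTop_add h2.neg
  exact ((tendsto_gaussPrim_atTop.comp h3).const_mul _).add
    ((tendsto_gaussPrim_atTop.comp h4).const_mul _)

lemma tendsto_chiPrim_zero {α : ℝ} (hα : 0 ≤ α) (w : ℝ) :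
    Tendsto (chiPrim α w) (𝓝[>] 0)
      (𝓝 (Real.exp (w * α) * (√π / 2) - Real.exp (-(w * α)) * (√π / 2))) := by
  have hs : Tendsto (fun u : ℝ => √u) (𝓝[>] 0) (𝓝[>] 0) := by
    refine tendsto_nhdsWithin_iff.2 ⟨?_, ?_⟩
    · simpa using (Real.continuous_sqrt.tendsto 0).mono_left nhdsWithin_le_nhds
    · filter_upwards [self_mem_nhdsWithin] with u hu using Real.sqrt_pos.2 hu
  have h1 : Tendsto (fun u : ℝ => w * √u) (𝓝[>] 0) (𝓝 (w * 0)) :=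
    (hs.mono_right nhdsWithin_le_nhds).const_mul w
  rcases hα.eq_or_lt with rfl | hpos
  · have h2 : Tendsto (fun u : ℝ => gaussPrim (w * √u)) (𝓝[>] 0) (𝓝 0) := by
      have h := (hasDerivAt_gaussPrim (w * 0)).continuousAt.tendsto.comp h1
      have h0 : gaussPrim (w * 0) = 0 := by simp [gaussPrim]
      rwa [h0] at h
    have he : chiPrim 0 w = fun u => gaussPrim (w * √u) + gaussPrim (w * √u) := by
      funext u
      simp [chiPrim]
    rw [he]
    simpa using h2.add h2
  · have h2 : Tendsto (fun u : ℝ => α / 2 * (√u)⁻¹) (𝓝[>] 0) atTop :=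
      (tendsto_inv_nhdsGT_zero.comp hs).const_mul_atTop (by positivity)
    have h3 : Tendsto (fun u : ℝ => w * √u + α / 2 * (√u)⁻¹) (𝓝[>] 0) atTop := h1.add_atTop h2
    have h4 : Tendsto (fun u : ℝ => w * √u - α / 2 * (√u)⁻¹) (𝓝[>] 0) atBot := by
      simpa [sub_eq_add_neg] using h1.add_atBot (tendsto_neg_atTop_atBot.comp h2)
    have := ((tendsto_gaussPrim_atTop.comp h3).const_mul (Real.exp (w * α))).add
      ((tendsto_gaussPrim_atBot.comp h4).const_mul (Real.exp (-(w * α))))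
    rwa [mul_neg, ← sub_eq_add_neg] at this

lemma chi_nonneg (α u : ℝ) : 0 ≤ chi α u := by unfold chi; positivity

lemma chi_real_laplace_aux {α : ℝ} (hα : 0 ≤ α) {w : ℝ} (hw : 0 < w) :
    IntegrableOn (fun u => Real.exp (-w ^ 2 * u) * chi α u) (Ioi 0) ∧
      ∫ u in Ioi (0:ℝ), Real.exp (-w ^ 2 * u) * chi α u = Real.exp (-(w * α)) / w := by
  set m := Real.exp (w * α) * (√π / 2) - Real.exp (-(w * α)) * (√π / 2) with hm
  have hpi : 0 < √π := Real.sqrt_pos.2 Real.pi_pos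
  have hcont : ContinuousWithinAt (Function.update (chiPrim α w) 0 m) (Ici 0) 0 := by
    rw [continuousWithinAt_update_same, Ici_sdiff_left]
    exact tendsto_chiPrim_zero hα w
  have hderiv : ∀ u ∈ Ioi (0:ℝ), HasDerivAt (Function.update (chiPrim α w) 0 m)
      (w * √π * (Real.exp (-w ^ 2 * u) * chi α u)) u := by
    intro u hu
    refine (hasDerivAt_chiPrim α w hu).congr_of_eventuallyEq ?_
    filter_upwards [lt_mem_nhds hu] with v hv
    rw [Function.update_of_ne hv.ne']
  have hpos : ∀ u ∈ Ioi (0:ℝ), 0 ≤ w * √π * (Real.exp (-w ^ 2 * u) * chi α u) := fun u _ => by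
    have := chi_nonneg α u
    positivity
  have htop : Tendsto (Function.update (chiPrim α w) 0 m) atTop
      (𝓝 (Real.exp (w * α) * (√π / 2) + Real.exp (-(w * α)) * (√π / 2))) := by
    refine (tendsto_chiPrim_atTop α hw).congr' ?_
    filter_upwards [eventually_gt_atTop 0] with v hv
    rw [Function.update_of_ne hv.ne']
  have hi := integrableOn_Ioi_deriv_of_nonneg hcont hderiv hpos htop
  have hv := integral_Ioi_of_hasDerivAt_of_nonneg hcont hderiv hpos htop
  have hne : w * √π ≠ 0 := by positivity
  refine ⟨(integrable_const_mul_iff (isUnit_iff_ne_zero.2 hne) _).1 hi, ?_⟩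
  rw [integral_const_mul, Function.update_self, hm] at hv
  rw [eq_div_iff hw.ne']
  apply mul_left_cancel₀ hpi.ne'
  linear_combination hv

lemma integrableOn_exp_mul_chi {α : ℝ} (hα : 0 ≤ α) {x : ℝ} (hx : 0 < x) :
    IntegrableOn (fun u => Real.exp (-x * u) * chi α u) (Ioi 0) := by
  have h := (chi_real_laplace_aux hα (Real.sqrt_pos.2 hx)).1
  rwa [Real.sq_sqrt hx.le] at h

lemma integral_exp_mul_chi {α : ℝ} (hα : 0 ≤ α) {x : ℝ} (hx : 0 < x) :
    ∫ u in Ioi (0:ℝ), Real.exp (-x * u) * chi α u = Real.exp (-(√x * α)) / √x := by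
  have h := (chi_real_laplace_aux hα (Real.sqrt_pos.2 hx)).2
  rwa [Real.sq_sqrt hx.le] at h

lemma measurable_chi_uncurry : Measurable fun p : ℝ × ℝ => chi p.1 p.2 := by
  unfold chi; fun_prop

lemma measurable_chi (α : ℝ) : Measurable (chi α) := by
  unfold chi; fun_prop

lemma measurable_nu : Measurable nu := by
  unfold nu; fun_prop

lemma norm_cexp_neg_mul_ofReal (z : ℂ) (u : ℝ) :
    ‖Complex.exp (-z * u)‖ = Real.exp (-z.re * u) := by
  simp [Complex.norm_exp]

lemma norm_cexp_mul_chi (z : ℂ) (α u : ℝ) :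
    ‖Complex.exp (-z * u) * (chi α u : ℂ)‖ = Real.exp (-z.re * u) * chi α u := by
  rw [norm_mul, norm_cexp_neg_mul_ofReal, Complex.norm_real, Real.norm_of_nonneg (chi_nonneg _ _)]

lemma measurable_cexp_mul_ofReal {f : ℝ → ℝ} (hf : Measurable f) (z : ℂ) :
    Measurable fun u : ℝ => Complex.exp (-z * u) * (f u : ℂ) := by
  fun_prop

lemma integrableOn_cexp_mul_chi {α : ℝ} (hα : 0 ≤ α) {z : ℂ} (hz : 0 < z.re) :
    IntegrableOn (fun u : ℝ => Complex.exp (-z * u) * (chi α u : ℂ)) (Ioi 0) := by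
  refine (integrableOn_exp_mul_chi hα hz).mono'
    (measurable_cexp_mul_ofReal (measurable_chi α) z).aestronglyMeasurable ?_
  exact Eventually.of_forall fun u => (norm_cexp_mul_chi z α u).le

lemma differentiableAt_laplace_chi {α : ℝ} (hα : 0 ≤ α) {z : ℂ} (hz : 0 < z.re) :
    DifferentiableAt ℂ (laplace (chi α)) z := by
  set ε := z.re / 3 with hε
  have hεpos : 0 < ε := by positivity
  have hs : {y : ℂ | 2 * ε < y.re} ∈ 𝓝 z :=
    (isOpen_lt continuous_const Complex.continuous_re).mem_nhds (by
      simp only [mem_ofPred_eq, hε]; linarith)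
  refine (hasDerivAt_integral_of_dominated_loc_of_deriv_le
    (F := fun (y : ℂ) (u : ℝ) => Complex.exp (-y * u) * (chi α u : ℂ))
    (F' := fun (y : ℂ) (u : ℝ) => -(u : ℂ) * (Complex.exp (-y * u) * (chi α u : ℂ)))
    (bound := fun u => ε⁻¹ * (Real.exp (-ε * u) * chi α u))
    hs ?_ (integrableOn_cexp_mul_chi hα hz) ?_ ?_ ?_ ?_).2.differentiableAt
  · exact Eventually.of_forall fun y =>
      (measurable_cexp_mul_ofReal (measurable_chi α) y).aestronglyMeasurable
  · exact (Complex.measurable_ofReal.neg.mul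
      (measurable_cexp_mul_ofReal (measurable_chi α) z)).aestronglyMeasurable
  · refine (ae_restrict_iff' measurableSet_Ioi).2 (Eventually.of_forall fun u hu y hy => ?_)
    have hu' : 0 < u := hu
    have hy' : 2 * ε < y.re := hy
    rw [norm_mul, norm_cexp_mul_chi, norm_neg, Complex.norm_real, Real.norm_of_nonneg hu'.le,
      ← mul_assoc, ← mul_assoc]
    refine mul_le_mul_of_nonneg_right ?_ (chi_nonneg α u)
    have h1 : Real.exp (-y.re * u) ≤ Real.exp (-ε * u) * Real.exp (-(ε * u)) := by
      rw [← Real.exp_add]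
      exact Real.exp_le_exp.2 (by nlinarith)
    have h2 : ε * u * Real.exp (-(ε * u)) ≤ 1 := by
      rw [Real.exp_neg, ← div_eq_mul_inv, div_le_one (Real.exp_pos _)]
      linarith [Real.add_one_le_exp (ε * u)]
    calc u * Real.exp (-y.re * u) ≤ u * (Real.exp (-ε * u) * Real.exp (-(ε * u))) := by gcongr
      _ = ε⁻¹ * Real.exp (-ε * u) * (ε * u * Real.exp (-(ε * u))) := by field_simp
      _ ≤ ε⁻¹ * Real.exp (-ε * u) * 1 := by gcongr
      _ = _ := mul_one _
  · exact (integrableOn_exp_mul_chi hα hεpos).const_mul _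
  · refine Eventually.of_forall fun u y _ => ?_
    have h := ((((hasDerivAt_id y).neg.mul_const (u : ℂ)).cexp).mul_const (chi α u : ℂ))
    refine h.congr_deriv ?_
    simp
    ring

lemma csqrt_sq (z : ℂ) : csqrt z ^ 2 = z := by
  rw [csqrt, one_div]
  exact_mod_cast Complex.cpow_nat_inv_pow z two_ne_zero

lemma csqrt_ofReal {x : ℝ} (hx : 0 ≤ x) : csqrt (x : ℂ) = (√x : ℝ) := by
  rw [csqrt, Real.sqrt_eq_rpow, Complex.ofReal_cpow hx]
  norm_num

lemma differentiableAt_csqrt {z : ℂ} (hz : 0 < z.re) : DifferentiableAt ℂ csqrt z :=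
  differentiableAt_id.cpow_const (Or.inl hz)

lemma csqrt_ne_zero {z : ℂ} (hz : z ≠ 0) : csqrt z ≠ 0 := by
  intro h
  apply hz
  rw [← csqrt_sq z, h]
  simp

/-- The Laplace transform of `χ_α` on the right half plane. -/
lemma laplace_chi {α : ℝ} (hα : 0 ≤ α) {z : ℂ} (hz : 0 < z.re) :
    laplace (chi α) z = Complex.exp (-(α : ℂ) * csqrt z) / csqrt z := by
  set U : Set ℂ := {y | 0 < y.re} with hU
  have hUo : IsOpen U := isOpen_lt continuous_const Complex.continuous_re
  have hUc : IsPreconnected U := (convex_halfSpace_re_gt 0).isPreconnected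
  have hf : AnalyticOnNhd ℂ (laplace (chi α)) U := DifferentiableOn.analyticOnNhd
    (fun y hy => (differentiableAt_laplace_chi hα hy).differentiableWithinAt) hUo
  have hg : AnalyticOnNhd ℂ (fun y => Complex.exp (-(α : ℂ) * csqrt y) / csqrt y) U := by
    refine DifferentiableOn.analyticOnNhd (fun y hy => ?_) hUo
    have hy0 : y ≠ 0 := by
      rintro rfl
      simp [hU] at hy
    have hd := differentiableAt_csqrt hy
    exact ((hd.const_mul _).cexp.div hd (csqrt_ne_zero hy0)).differentiableWithinAt
  have hreal : ∀ x : ℝ, 0 < x → laplace (chi α) x =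
      Complex.exp (-(α : ℂ) * csqrt x) / csqrt x := by
    intro x hx
    rw [csqrt_ofReal hx.le]
    have h := congrArg (Complex.ofReal) (integral_exp_mul_chi hα hx)
    rw [← integral_complex_ofReal] at h
    rw [laplace]
    convert h using 1
    · simp
    · push_cast
      rw [neg_mul, mul_comm (α : ℂ)]
  refine hf.eqOn_of_preconnected_of_frequently_eq hg hUc (z₀ := 1) (by simp [hU]) ?_ hz
  have ht : Tendsto (fun x : ℝ => (x : ℂ)) (𝓝[≠] 1) (𝓝[≠] 1) := by
    refine tendsto_nhdsWithin_iff.2 ⟨?_, ?_⟩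
    · simpa using (Complex.continuous_ofReal.tendsto 1).mono_left nhdsWithin_le_nhds
    · filter_upwards [self_mem_nhdsWithin] with x hx
      simpa using hx
  refine ht.frequently (Eventually.frequently ?_)
  filter_upwards [mem_nhdsWithin_of_mem_nhds (lt_mem_nhds one_pos)] with x hx using hreal x hx

lemma chi_le_chi_zero (α : ℝ) {u : ℝ} (hu : 0 < u) : chi α u ≤ chi 0 u := by
  unfold chi
  gcongr ?_ * Real.exp ?_
  have : 0 ≤ α ^ 2 / (4 * u) := by positivity
  rw [neg_div]
  simpa using this

lemma nu_nonneg {u : ℝ} (hu : 0 < u) : 0 ≤ nu u := by unfold nu; positivity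

lemma nu_le_chi_zero {u : ℝ} (hu : 0 < u) : nu u ≤ chi 0 u := by
  have hs : 0 < √u := Real.sqrt_pos.2 hu
  have hpi : 0 < √π := Real.sqrt_pos.2 Real.pi_pos
  have hsq : √u ^ 2 = u := Real.sq_sqrt hu.le
  rw [nu, chi, Real.sqrt_mul Real.pi_pos.le]
  simp only [ne_eq, OfNat.ofNat_ne_zero, not_false_eq_true, zero_pow, neg_zero, zero_div,
    Real.exp_zero, mul_one]
  rw [div_le_div_iff₀ (by positivity) (by positivity)]
  field_simp
  nlinarith

lemma integrableOn_cexp_mul_nu {z : ℂ} (hz : 0 < z.re) :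
    IntegrableOn (fun u : ℝ => Complex.exp (-z * u) * (nu u : ℂ)) (Ioi 0) := by
  refine (integrableOn_exp_mul_chi le_rfl hz).mono'
    (measurable_cexp_mul_ofReal measurable_nu z).aestronglyMeasurable ?_
  refine (ae_restrict_iff' measurableSet_Ioi).2 (Eventually.of_forall fun u hu => ?_)
  rw [norm_mul, norm_cexp_neg_mul_ofReal, Complex.norm_real, Real.norm_of_nonneg (nu_nonneg hu)]
  exact mul_le_mul_of_nonneg_left (nu_le_chi_zero hu) (Real.exp_pos _).le

/-- `ν` is a Rayleigh mixture of the functions `χ_x`. -/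
lemma integral_mul_exp_mul_chi {u : ℝ} (hu : 0 < u) :
    ∫ x in Ioi (0:ℝ), (x:ℂ) * Complex.exp (-(x:ℂ)^2/2) * (chi x u : ℂ) = (nu u : ℂ) := by
  have hb : (0:ℝ) < 1 / 2 + 1 / (4 * u) := by positivity
  have h := integral_mul_cexp_neg_mul_sq (b := ((1 / 2 + 1 / (4 * u) : ℝ) : ℂ))
    (by rwa [Complex.ofReal_re])
  have hpt : ∀ x : ℝ, (x:ℂ) * Complex.exp (-(x:ℂ)^2/2) * (chi x u : ℂ) =
      ((1 / √(π * u) : ℝ) : ℂ) *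
        ((x:ℂ) * Complex.exp (-((1 / 2 + 1 / (4 * u) : ℝ) : ℂ) * (x:ℂ) ^ 2)) := by
    intro x
    have he : -((1 / 2 + 1 / (4 * u) : ℝ) : ℂ) * (x:ℂ) ^ 2 =
        -(x:ℂ)^2/2 + ((-x ^ 2 / (4 * u) : ℝ) : ℂ) := by
      push_cast
      ring
    rw [he, Complex.exp_add, chi]
    push_cast
    ring
  simp_rw [hpt]
  rw [integral_const_mul, h]
  have hs : 0 < √u := Real.sqrt_pos.2 hu
  have hpi : 0 < √π := Real.sqrt_pos.2 Real.pi_pos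
  have hsq : √u ^ 2 = u := Real.sq_sqrt hu.le
  have key : (1 / √(π * u)) * (2 * (1 / 2 + 1 / (4 * u)))⁻¹ = nu u := by
    rw [nu, Real.sqrt_mul Real.pi_pos.le]
    field_simp
    rw [hsq]
    ring
  rw [← key]
  push_cast
  rfl

/-- The Laplace transform of `ν` on the right half plane. -/
lemma laplace_nu {z : ℂ} (hz : 0 < z.re) : laplace nu z = Psi (-csqrt z) / csqrt z := by
  have hprod : Integrable (Function.uncurry fun x u : ℝ =>
      (x:ℂ) * Complex.exp (-(x:ℂ)^2/2) * (Complex.exp (-z * u) * (chi x u : ℂ)))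
      ((volume.restrict (Ioi 0)).prod (volume.restrict (Ioi 0))) := by
    have hb := ((integrable_mul_exp_neg_mul_sq (b := 1 / 2) (by norm_num)).integrableOn
      (s := Ioi 0)).mul_prod (integrableOn_exp_mul_chi (le_refl (0:ℝ)) hz)
    refine hb.mono' (Measurable.aestronglyMeasurable ?_) ?_
    · have := measurable_chi_uncurry
      unfold Function.uncurry
      fun_prop
    · rw [Measure.prod_restrict]
      refine (ae_restrict_iff' (measurableSet_Ioi.prod measurableSet_Ioi)).2
        (Eventually.of_forall fun p hp => ?_)
      have hx : 0 < p.1 := hp.1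
      have hu : 0 < p.2 := hp.2
      have he : ‖Complex.exp (-(p.1:ℂ)^2/2)‖ = Real.exp (-(1 / 2) * p.1 ^ 2) := by
        have : -(p.1:ℂ)^2/2 = ((-(1 / 2) * p.1 ^ 2 : ℝ) : ℂ) := by push_cast; ring
        rw [this, Complex.norm_exp, Complex.ofReal_re]
      rw [Function.uncurry, norm_mul, norm_cexp_mul_chi, norm_mul, he, Complex.norm_real,
        Real.norm_of_nonneg hx.le]
      have := chi_le_chi_zero p.1 hu
      gcongr
  have hswap := integral_integral_swap hprod
  have hleft : ∫ x in Ioi (0:ℝ), ∫ u in Ioi (0:ℝ),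
      (x:ℂ) * Complex.exp (-(x:ℂ)^2/2) * (Complex.exp (-z * u) * (chi x u : ℂ)) =
      Psi (-csqrt z) / csqrt z := by
    rw [Psi, ← integral_div]
    refine setIntegral_congr_fun measurableSet_Ioi fun x hx => ?_
    have h := laplace_chi (le_of_lt (mem_Ioi.1 hx)) hz
    rw [laplace] at h
    rw [integral_const_mul, h, Complex.exp_add, neg_mul, neg_mul, mul_comm (x:ℂ) (csqrt z)]
    ring
  rw [← hleft, hswap, laplace]
  refine setIntegral_congr_fun measurableSet_Ioi fun u hu => ?_
  rw [← integral_mul_exp_mul_chi hu, ← integral_const_mul]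
  congr 1
  funext x
  ring

/-- The Laplace transform turns convolution on `(0,∞)` into a product. -/
lemma laplace_pconv {f g : ℝ → ℝ} {z : ℂ}
    (hf : IntegrableOn (fun u : ℝ => Complex.exp (-z * u) * (f u : ℂ)) (Ioi 0))
    (hg : IntegrableOn (fun u : ℝ => Complex.exp (-z * u) * (g u : ℂ)) (Ioi 0)) :
    laplace (pconv f g) z = laplace f z * laplace g z := by
  have h := integral_posConvolution hf hg (ContinuousLinearMap.mul ℝ ℂ)
  simp only [ContinuousLinearMap.mul_apply'] at h
  rw [laplace, laplace, laplace, ← h]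
  congr 1
  funext u
  rw [pconv, ← intervalIntegral.integral_ofReal, ← intervalIntegral.integral_const_mul]
  congr 1
  funext t
  have : -z * (u : ℂ) = -z * t + -z * ((u - t : ℝ) : ℂ) := by push_cast; ring
  rw [this, Complex.exp_add]
  push_cast
  ring

/-- For every real `α ≥ 0` and `Re z > 0`: `L(χ_α ∗ ν)(z) = exp(−α·√z)·Ψ(−√z)/z`,
the convolution being taken on `(0,∞)`. -/
theorem laplace_chi_conv_nu (α : ℝ) (hα : 0 ≤ α) (z : ℂ) (hz : 0 < z.re) :
    laplace (pconv (chi α) nu) z = Complex.exp (-(α : ℂ) * csqrt z) * Psi (-csqrt z) / z := by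
  rw [laplace_pconv (integrableOn_cexp_mul_chi hα hz) (integrableOn_cexp_mul_nu hz),
    laplace_chi hα hz, laplace_nu hz, div_mul_div_comm, ← sq, csqrt_sq]
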